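/- Let 1 < p < 2 and D₁, D₂ > 0. Suppose (Fₙ) is a sequence of nonnegative reals with Fₙ → 0, and (tₙ), (sₙ) are sequences with tₙ > 1, sₙ > 1 satisfying tₙ² D₁ = tₙ^{2p} D₁ − tₙ^p sₙ^p Fₙ and sₙ² D₂ = sₙ^{2p} D₂ − tₙ^p sₙ^p Fₙ for every n. Then tₙ → 1 and sₙ → 1. -/

import Mathlib

open Real Filter

lemma key_aux (p : ℝ) (hp1 : 1 < p) (D E F t s : ℝ) (hD : 0 < D) (hDE : D ≤ E)
    (hF : 0 ≤ F) (hFD : F < D) (ht : 1 < t) (hts : t ≤ s)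
    (h : s ^ 2 * E = s ^ (2 * p) * E - t ^ p * s ^ p * F) :
    s ≤ (1 - F / D) ^ (1 / (2 - 2 * p)) := by
  have hs : 0 < s := by linarith
  have hy : 0 < 1 - F / D := by
    rw [sub_pos, div_lt_one hD]; exact hFD
  have h1 : t ^ p ≤ s ^ p := Real.rpow_le_rpow (by linarith) hts (by linarith)
  have hsp : 0 < s ^ p := Real.rpow_pos_of_pos hs p
  have h2p : s ^ (2 * p) = s ^ p * s ^ p := by
    rw [← Real.rpow_add hs]; ring_nf
  have hE : 0 < E := by linarith
  have hEF : F / E ≤ F / D := by gcongr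
  have h3 : (1 - F / D) * s ^ (2 * p) ≤ s ^ 2 := by
    have : (1 - F / E) * s ^ (2 * p) ≤ s ^ 2 := by
      have e : (1 - F / E) * s ^ (2 * p) = (s ^ (2 * p) * E - s ^ p * s ^ p * F) / E := by
        rw [h2p]; field_simp
      rw [e, div_le_iff₀ hE, h]
      have : t ^ p * s ^ p * F ≤ s ^ p * s ^ p * F := by gcongr
      linarith
    have : (1 - F / D) * s ^ (2 * p) ≤ (1 - F / E) * s ^ (2 * p) := by
      gcongr
    linarith
  have h4 : 1 - F / D ≤ s ^ (2 - 2 * p) := by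
    rw [Real.rpow_sub hs, le_div_iff₀ (Real.rpow_pos_of_pos hs _)]
    simpa using h3
  have h5 := Real.rpow_le_rpow_of_nonpos hy h4
    (show 1 / (2 - 2 * p) ≤ 0 from div_nonpos_of_nonneg_of_nonpos (by norm_num) (by linarith))
  rwa [← Real.rpow_mul hs.le, mul_one_div_cancel (by linarith), Real.rpow_one] at h5

theorem stmt_11 (p : ℝ) (hp1 : 1 < p) (hp2 : p < 2)
    (D₁ D₂ : ℝ) (hD₁ : 0 < D₁) (hD₂ : 0 < D₂)
    (F t s : ℕ → ℝ) (hF0 : ∀ n, 0 ≤ F n) (hF : Tendsto F atTop (nhds 0))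
    (ht : ∀ n, 1 < t n) (hs : ∀ n, 1 < s n)
    (h1 : ∀ n, (t n) ^ 2 * D₁ = (t n) ^ (2 * p) * D₁ - (t n) ^ p * (s n) ^ p * F n)
    (h2 : ∀ n, (s n) ^ 2 * D₂ = (s n) ^ (2 * p) * D₂ - (t n) ^ p * (s n) ^ p * F n) :
    Tendsto t atTop (nhds 1) ∧ Tendsto s atTop (nhds 1) := by
  have hD : 0 < min D₁ D₂ := lt_min hD₁ hD₂
  have hev : ∀ᶠ n in atTop, F n < min D₁ D₂ := hF.eventually_lt_const hD
  have hlim : Tendsto (fun n => (1 - F n / min D₁ D₂) ^ (1 / (2 - 2 * p))) atTop (nhds 1) := by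
    have h := ((hF.div_const (min D₁ D₂)).const_sub 1).rpow_const
      (p := 1 / (2 - 2 * p)) (Or.inl (by simp))
    simpa using h
  have hb : ∀ᶠ n in atTop, t n ≤ (1 - F n / min D₁ D₂) ^ (1 / (2 - 2 * p)) ∧
      s n ≤ (1 - F n / min D₁ D₂) ^ (1 / (2 - 2 * p)) := by
    filter_upwards [hev] with n hn
    rcases le_total (t n) (s n) with h | h
    · have := key_aux p hp1 _ D₂ (F n) (t n) (s n) hD (min_le_right _ _) (hF0 n) hn (ht n) h (h2 n)
      exact ⟨h.trans this, this⟩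
    · have := key_aux p hp1 _ D₁ (F n) (s n) (t n) hD (min_le_left _ _) (hF0 n) hn (hs n) h
        (by rw [h1 n]; ring)
      exact ⟨this, h.trans this⟩
  exact ⟨tendsto_of_tendsto_of_tendsto_of_le_of_le' tendsto_const_nhds hlim
      (Eventually.of_forall fun n => (ht n).le) (hb.mono fun n h => h.1),
    tendsto_of_tendsto_of_tendsto_of_le_of_le' tendsto_const_nhds hlim
      (Eventually.of_forall fun n => (hs n).le) (hb.mono fun n h => h.2)⟩
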